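/- For any t, n, k ∈ ℕ, the total variation distance between the joint distribution of the subsampled block (Z_t, Z_{k+t}, Z_{2k+t}, …, Z_{(n−1)k+t}) and the product of its marginal distributions P_t × P_{k+t} × ⋯ × P_{(n−1)k+t} is at most (n−1)·β_k. -/

import Mathlib

open MeasureTheory ProbabilityTheory

noncomputable section

/-- `F` pseudo-shatters `k` points: there are points `z i` and thresholds `w i`
realizing all `2^k` boolean patterns `(𝟙[f (z i) ≤ w i])_i` as `f` ranges over `F`. -/
def PseudoShatters {Z : Type*} (F : Set (Z → ℝ)) (k : ℕ) : Prop :=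
  ∃ (z : Fin k → Z) (w : Fin k → ℝ),
    ∀ b : Fin k → Bool, ∃ f ∈ F, ∀ i, (f (z i) ≤ w i ↔ b i = true)

/-- `d` is the pseudo-dimension of `F`. -/
def IsPseudoDim {Z : Type*} (F : Set (Z → ℝ)) (d : ℕ) : Prop :=
  PseudoShatters F d ∧ ∀ k, PseudoShatters F k → k ≤ d

/-- the discrepancy `ρ(P,Q) = sup_{f ∈ F} |E_P f - E_Q f|`. -/
def disc {Z : Type*} [MeasurableSpace Z] (F : Set (Z → ℝ)) (P Q : Measure Z) : ℝ :=
  ⨆ f : F, |∫ z, (f : Z → ℝ) z ∂P - ∫ z, (f : Z → ℝ) z ∂Q|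

/-- total variation distance `‖P - Q‖ = sup_A P(A) - Q(A)`. -/
def tvDist {Z : Type*} [MeasurableSpace Z] (P Q : Measure Z) : ℝ :=
  ⨆ A : {A : Set Z // MeasurableSet A}, ((P A.1).toReal - (Q A.1).toReal)

/-- the σ-algebra generated by the random variables `Zs i` for `i ∈ S`. -/
def sigmaGen {Ω Z : Type*} [mZ : MeasurableSpace Z] (Zs : ℕ → Ω → Z) (S : Set ℕ) :
    MeasurableSpace Ω :=
  ⨆ i ∈ S, MeasurableSpace.comap (Zs i) mZ

/-- `A` is a finite partition of `Ω` into sets measurable w.r.t. `m`. -/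
def IsFinPartition {Ω : Type*} (m : MeasurableSpace Ω) {n : ℕ} (A : Fin n → Set Ω) : Prop :=
  (∀ i, MeasurableSet[m] (A i)) ∧ Pairwise (Function.onFun Disjoint A) ∧ (⋃ i, A i) = Set.univ

/-- the β-mixing coefficient `β_k` of the process `Zs` (indexed from 1) under `μ`. -/
def betaMix {Ω Z : Type*} [MeasurableSpace Ω] [MeasurableSpace Z]
    (μ : Measure Ω) (Zs : ℕ → Ω → Z) (k : ℕ) : ℝ :=
  sSup {x : ℝ | ∃ (ℓ I J : ℕ), 1 ≤ ℓ ∧ ∃ (A : Fin I → Set Ω) (B : Fin J → Set Ω),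
    IsFinPartition (sigmaGen Zs (Set.Icc 1 ℓ)) A ∧
    IsFinPartition (sigmaGen Zs (Set.Ici (ℓ + k))) B ∧
    x = (1/2) * ∑ i, ∑ j,
      |(μ (A i ∩ B j)).toReal - (μ (A i)).toReal * (μ (B j)).toReal|}

end

/-- Sets that are unions of cells of a finite measurable grid on `α × β`. -/
def gridSets (α β : Type*) [MeasurableSpace α] [MeasurableSpace β] : Set (Set (α × β)) :=
  {s | ∃ (I J : ℕ) (f : α → Fin I) (g : β → Fin J) (S : Set (Fin I × Fin J)),
    Measurable f ∧ Measurable g ∧ s = Prod.map f g ⁻¹' S}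

lemma compl_mem_gridSets {α β : Type*} [MeasurableSpace α] [MeasurableSpace β]
    {s : Set (α × β)} (hs : s ∈ gridSets α β) : sᶜ ∈ gridSets α β := by
  obtain ⟨I, J, f, g, S, hf, hg, rfl⟩ := hs
  exact ⟨I, J, f, g, Sᶜ, hf, hg, rfl⟩

lemma inter_mem_gridSets {α β : Type*} [MeasurableSpace α] [MeasurableSpace β]
    {s t : Set (α × β)} (hs : s ∈ gridSets α β) (ht : t ∈ gridSets α β) :
    s ∩ t ∈ gridSets α β := by
  obtain ⟨I, J, f, g, S, hf, hg, rfl⟩ := hs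
  obtain ⟨I', J', f', g', S', hf', hg', rfl⟩ := ht
  refine ⟨I * I', J * J', fun x => finProdFinEquiv (f x, f' x),
    fun y => finProdFinEquiv (g y, g' y),
    {p | ((finProdFinEquiv.symm p.1).1, (finProdFinEquiv.symm p.2).1) ∈ S ∧
      ((finProdFinEquiv.symm p.1).2, (finProdFinEquiv.symm p.2).2) ∈ S'},
    (measurable_of_countable _).comp (hf.prodMk hf'),
    (measurable_of_countable _).comp (hg.prodMk hg'), ?_⟩
  ext ⟨x, y⟩
  simp [Prod.map, -finProdFinEquiv_symm_apply]

lemma prod_mem_gridSets {α β : Type*} [MeasurableSpace α] [MeasurableSpace β]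
    {s : Set α} {t : Set β} (hs : MeasurableSet s) (ht : MeasurableSet t) :
    s ×ˢ t ∈ gridSets α β := by
  classical
  refine ⟨2, 2, fun x => if x ∈ s then 1 else 0, fun y => if y ∈ t then 1 else 0, {(1, 1)},
    Measurable.ite hs measurable_const measurable_const,
    Measurable.ite ht measurable_const measurable_const, ?_⟩
  ext ⟨x, y⟩
  simp [Prod.map]

lemma measurableSet_of_mem_gridSets {α β : Type*} [MeasurableSpace α] [MeasurableSpace β]
    {s : Set (α × β)} (hs : s ∈ gridSets α β) : MeasurableSet s := by
  obtain ⟨I, J, f, g, S, hf, hg, rfl⟩ := hs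
  exact (hf.prodMap hg) S.to_countable.measurableSet

lemma isSetRing_gridSets (α β : Type*) [MeasurableSpace α] [MeasurableSpace β] :
    IsSetRing (gridSets α β) where
  empty_mem := by simpa using prod_mem_gridSets (α := α) (β := β) .empty .empty
  union_mem s t hs ht := by
    simpa [Set.compl_inter] using
      compl_mem_gridSets (inter_mem_gridSets (compl_mem_gridSets hs) (compl_mem_gridSets ht))
  sdiff_mem s t hs ht := inter_mem_gridSets hs (compl_mem_gridSets ht)

lemma generateFrom_gridSets (α β : Type*) [MeasurableSpace α] [MeasurableSpace β] :
    (inferInstance : MeasurableSpace (α × β)) = MeasurableSpace.generateFrom (gridSets α β) := by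
  apply le_antisymm
  · rw [← generateFrom_prod]
    refine MeasurableSpace.generateFrom_mono ?_
    rintro _ ⟨s, hs, t, ht, rfl⟩
    exact prod_mem_gridSets hs ht
  · exact MeasurableSpace.generateFrom_le fun s hs => measurableSet_of_mem_gridSets hs

/-- A bound on `P s - Q s` over grid sets extends to all measurable sets. -/
lemma measureReal_sub_le_of_gridSets {α β : Type*} [MeasurableSpace α] [MeasurableSpace β]
    (P Q : Measure (α × β)) [IsFiniteMeasure P] [IsFiniteMeasure Q] {c : ℝ}
    (h : ∀ s ∈ gridSets α β, P.real s - Q.real s ≤ c) {s : Set (α × β)} (hs : MeasurableSet s) :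
    P.real s - Q.real s ≤ c := by
  refine le_of_forall_pos_le_add fun ε hε => ?_
  obtain ⟨u, hu, hus⟩ := exists_measure_symmDiff_lt_of_generateFrom_isSetRing (μ := P + Q)
    (isSetRing_gridSets α β)
    ⟨{Set.univ}, by simp, by
      simpa using! prod_mem_gridSets (α := α) (β := β) .univ .univ, by simp⟩
    (generateFrom_gridSets α β) hs (ENNReal.ofReal_pos.2 hε)
  have hum := measurableSet_of_mem_gridSets hu
  have hadd : P.real (symmDiff u s) + Q.real (symmDiff u s) ≤ ε := by
    rw [← measureReal_add_apply]
    exact ENNReal.toReal_le_of_le_ofReal hε.le hus.le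
  have h1 := abs_le.1 (abs_measureReal_sub_le_measureReal_symmDiff (μ := P)
    hum.nullMeasurableSet hs.nullMeasurableSet)
  have h2 := abs_le.1 (abs_measureReal_sub_le_measureReal_symmDiff (μ := Q)
    hum.nullMeasurableSet hs.nullMeasurableSet)
  linarith [h u hu]

lemma sum_le_half_sum_abs {ι : Type*} [Fintype ι] (d : ι → ℝ) (hd : ∑ i, d i = 0)
    (S : Finset ι) : ∑ i ∈ S, d i ≤ (1 / 2) * ∑ i, |d i| := by
  classical
  rw [← Finset.sum_add_sum_compl S] at hd ⊢
  have h1 : ∑ i ∈ S, d i ≤ ∑ i ∈ S, |d i| := Finset.sum_le_sum fun i _ => le_abs_self _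
  have h2 : -∑ i ∈ Sᶜ, d i ≤ ∑ i ∈ Sᶜ, |d i| := by
    rw [← Finset.sum_neg_distrib]
    exact Finset.sum_le_sum fun i _ => neg_le_abs _
  linarith

/-- The half-`ℓ¹` distances of two probability measures on finite grids control the difference
of the measures on every measurable set. -/
lemma measureReal_sub_le_of_grid_sum {α β : Type*} [MeasurableSpace α] [MeasurableSpace β]
    (P Q : Measure (α × β)) [IsProbabilityMeasure P] [IsProbabilityMeasure Q] {c : ℝ}
    (h : ∀ (I J : ℕ) (f : α → Fin I) (g : β → Fin J), Measurable f → Measurable g →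
      (1 / 2) * ∑ i, ∑ j, |P.real ((f ⁻¹' {i}) ×ˢ (g ⁻¹' {j}))
        - Q.real ((f ⁻¹' {i}) ×ˢ (g ⁻¹' {j}))| ≤ c)
    {s : Set (α × β)} (hs : MeasurableSet s) : P.real s - Q.real s ≤ c := by
  refine measureReal_sub_le_of_gridSets P Q ?_ hs
  rintro _ ⟨I, J, f, g, S, hf, hg, rfl⟩
  classical
  have key (R : Measure (α × β)) [IsProbabilityMeasure R] (T : Finset (Fin I × Fin J)) :
      R.real (Prod.map f g ⁻¹' (T : Set (Fin I × Fin J)))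
        = ∑ p ∈ T, R.real ((f ⁻¹' {p.1}) ×ˢ (g ⁻¹' {p.2})) := by
    rw [← sum_measureReal_preimage_singleton T fun p _ => (hf.prodMap hg) (.singleton p)]
    refine Finset.sum_congr rfl fun p _ => ?_
    congr 1
    ext ⟨x, y⟩
    simp [Prod.ext_iff]
  have hS : S = (S.toFinset : Set (Fin I × Fin J)) := by simp
  rw [hS, key, key, ← Finset.sum_sub_distrib]
  refine (sum_le_half_sum_abs (fun p : Fin I × Fin J =>
    P.real ((f ⁻¹' {p.1}) ×ˢ (g ⁻¹' {p.2})) - Q.real ((f ⁻¹' {p.1}) ×ˢ (g ⁻¹' {p.2}))) ?_ _).trans ?_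
  · rw [Finset.sum_sub_distrib, ← key, ← key]
    simp
  · rw [Fintype.sum_prod_type]
    exact h I J f g hf hg

lemma sigmaGen_le {Ω Z : Type*} [mΩ : MeasurableSpace Ω] [MeasurableSpace Z] {Zs : ℕ → Ω → Z}
    (hZs : ∀ t, Measurable (Zs t)) (S : Set ℕ) : sigmaGen Zs S ≤ mΩ :=
  iSup₂_le fun i _ => (hZs i).comap_le

lemma measurable_sigmaGen {Ω Z : Type*} [mZ : MeasurableSpace Z] (Zs : ℕ → Ω → Z) {S : Set ℕ}
    {i : ℕ} (hi : i ∈ S) : Measurable[sigmaGen Zs S] (Zs i) :=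
  (comap_measurable (Zs i)).mono
    (le_iSup₂ (f := fun i (_ : i ∈ S) => MeasurableSpace.comap (Zs i) mZ) i hi) le_rfl

lemma isFinPartition_preimage {Ω : Type*} (m : MeasurableSpace Ω) {n : ℕ} {f : Ω → Fin n}
    (hf : Measurable[m] f) : IsFinPartition m fun i => f ⁻¹' {i} := by
  refine ⟨fun i => hf (.singleton i), fun i j hij => ?_, ?_⟩
  · exact (Set.disjoint_singleton.2 hij).preimage f
  · ext
    simp

lemma IsFinPartition.sum_measureReal_inter {Ω : Type*} [mΩ : MeasurableSpace Ω] (μ : Measure Ω)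
    [IsFiniteMeasure μ] {m : MeasurableSpace Ω} (hm : m ≤ mΩ) {n : ℕ} {A : Fin n → Set Ω}
    (hA : IsFinPartition m A) {s : Set Ω}
    (hs : MeasurableSet[mΩ] s) :
    ∑ i, μ.real (A i ∩ s) = μ.real s := by
  rw [← measureReal_iUnion_fintype, ← Set.iUnion_inter, hA.2.2, Set.univ_inter]
  · exact fun i j hij => (hA.2.1 hij).mono Set.inter_subset_left Set.inter_subset_left
  · exact fun i => (hm _ (hA.1 i)).inter hs

lemma bddAbove_betaMix {Ω Z : Type*} [mΩ : MeasurableSpace Ω] [MeasurableSpace Z]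
    (μ : Measure Ω) [IsProbabilityMeasure μ] {Zs : ℕ → Ω → Z} (hZs : ∀ t, Measurable (Zs t))
    (k : ℕ) :
    BddAbove {x : ℝ | ∃ (ℓ I J : ℕ), 1 ≤ ℓ ∧ ∃ (A : Fin I → Set Ω) (B : Fin J → Set Ω),
      IsFinPartition (sigmaGen Zs (Set.Icc 1 ℓ)) A ∧
      IsFinPartition (sigmaGen Zs (Set.Ici (ℓ + k))) B ∧
      x = (1/2) * ∑ i, ∑ j,
        |(μ (A i ∩ B j)).toReal - (μ (A i)).toReal * (μ (B j)).toReal|} := by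
  refine ⟨1, ?_⟩
  rintro _ ⟨ℓ, I, J, -, A, B, hA, hB, rfl⟩
  have hAm := sigmaGen_le hZs (Set.Icc 1 ℓ)
  have hBm := sigmaGen_le hZs (Set.Ici (ℓ + k))
  have hA1 : ∑ i, μ.real (A i) = 1 := by
    simpa using hA.sum_measureReal_inter μ hAm .univ
  have hB1 : ∑ j, μ.real (B j) = 1 := by
    simpa using hB.sum_measureReal_inter μ hBm .univ
  have hAB : ∑ i, ∑ j, μ.real (A i ∩ B j) = 1 := by
    rw [Finset.sum_comm, ← hB1]
    exact Finset.sum_congr rfl fun j _ => hA.sum_measureReal_inter μ hAm (hBm _ (hB.1 j))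
  have hprod : ∑ i, ∑ j, μ.real (A i) * μ.real (B j) = 1 := by
    rw [← Finset.sum_mul_sum, hA1, hB1, one_mul]
  have hle : ∑ i, ∑ j, |μ.real (A i ∩ B j) - μ.real (A i) * μ.real (B j)|
      ≤ ∑ i, ∑ j, (μ.real (A i ∩ B j) + μ.real (A i) * μ.real (B j)) := by
    refine Finset.sum_le_sum fun i _ => Finset.sum_le_sum fun j _ => ?_
    have h1 : 0 ≤ μ.real (A i ∩ B j) := measureReal_nonneg
    have h2 : 0 ≤ μ.real (A i) * μ.real (B j) := by positivity
    rw [abs_le]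
    constructor <;> linarith
  simp only [Finset.sum_add_distrib] at hle
  rw [hAB, hprod] at hle
  simp only [Measure.real] at hle
  linarith

/-- The joint law of a past-measurable and a `k`-delayed future-measurable variable is within
`betaMix μ Zs k` of the product of its marginals. -/
lemma measureReal_map_prodMk_sub_le_betaMix {Ω Z : Type*} [MeasurableSpace Ω] [MeasurableSpace Z]
    (μ : Measure Ω) [IsProbabilityMeasure μ] {Zs : ℕ → Ω → Z} (hZs : ∀ t, Measurable (Zs t))
    {k ℓ : ℕ} (hℓ : 1 ≤ ℓ) {α β : Type*} [MeasurableSpace α] [MeasurableSpace β]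
    {X : Ω → α} {Y : Ω → β} (hX : Measurable[sigmaGen Zs (Set.Icc 1 ℓ)] X)
    (hY : Measurable[sigmaGen Zs (Set.Ici (ℓ + k))] Y)
    {s : Set (α × β)} (hs : MeasurableSet s) :
    (μ.map fun ω => (X ω, Y ω)).real s - ((μ.map X).prod (μ.map Y)).real s
      ≤ betaMix μ Zs k := by
  have hX' : Measurable X := hX.mono (sigmaGen_le hZs _) le_rfl
  have hY' : Measurable Y := hY.mono (sigmaGen_le hZs _) le_rfl
  have := Measure.isProbabilityMeasure_map (μ := μ) hX'.aemeasurable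
  have := Measure.isProbabilityMeasure_map (μ := μ) hY'.aemeasurable
  have := Measure.isProbabilityMeasure_map (μ := μ) (hX'.prodMk hY').aemeasurable
  refine measureReal_sub_le_of_grid_sum _ _ (fun I J f g hf hg => ?_) hs
  refine le_csSup (bddAbove_betaMix μ hZs k) ⟨ℓ, I, J, hℓ, _, _,
    isFinPartition_preimage _ (hf.comp hX), isFinPartition_preimage _ (hg.comp hY), ?_⟩
  congr 1
  refine Finset.sum_congr rfl fun i _ => Finset.sum_congr rfl fun j _ => ?_
  have hfi := hf (.singleton i)
  have hgj := hg (.singleton j)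
  rw [measureReal_prod_prod, map_measureReal_apply hX' hfi, map_measureReal_apply hY' hgj,
    map_measureReal_apply (hX'.prodMk hY') (hfi.prod hgj)]
  rfl

/-- Replacing the first factor of a product measure by another one changes the measure of a set
by at most as much as it changes the measures of the sections. -/
lemma measureReal_prod_sub_le {α β : Type*} [MeasurableSpace α] [MeasurableSpace β]
    (P Q : Measure α) [IsFiniteMeasure P] [IsFiniteMeasure Q] (ν : Measure β)
    [IsProbabilityMeasure ν] {c : ℝ}
    (h : ∀ s, MeasurableSet s → P.real s - Q.real s ≤ c) {s : Set (α × β)}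
    (hs : MeasurableSet s) : (P.prod ν).real s - (Q.prod ν).real s ≤ c := by
  have key (T : Measure α) [IsFiniteMeasure T] :
      Integrable (fun y => T.real ((fun x => (x, y)) ⁻¹' s)) ν ∧
      (T.prod ν).real s = ∫ y, T.real ((fun x => (x, y)) ⁻¹' s) ∂ν := by
    have hm : Measurable fun y => T ((fun x => (x, y)) ⁻¹' s) :=
      measurable_measure_prodMk_right hs
    refine ⟨.of_bound hm.ennreal_toReal.aestronglyMeasurable (T.real Set.univ)
      (.of_forall fun y => ?_), ?_⟩
    · rw [Real.norm_of_nonneg measureReal_nonneg]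
      exact measureReal_mono (Set.subset_univ _)
    · simp only [Measure.real]
      rw [integral_toReal hm.aemeasurable (.of_forall fun y => measure_lt_top _ _),
        Measure.prod_apply_symm hs]
  rw [(key P).2, (key Q).2, ← integral_sub (key P).1 (key Q).1]
  calc _ ≤ ∫ _, c ∂ν := integral_mono ((key P).1.sub (key Q).1) (integrable_const c)
        fun y => h _ (measurable_prodMk_right hs)
    _ = c := by simp

lemma measureReal_block_sub_le {Ω : Type*} [MeasurableSpace Ω] (μ : Measure Ω)
    [IsProbabilityMeasure μ] {Z : Type*} [MeasurableSpace Z] {Zs : ℕ → Ω → Z}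
    (hZs : ∀ t, Measurable (Zs t)) {t k : ℕ} (ht : 1 ≤ t) (m : ℕ)
    {s : Set (Fin (m + 1) → Z)} (hs : MeasurableSet s) :
    (μ.map (fun ω => fun j : Fin (m + 1) => Zs ((j : ℕ) * k + t) ω)).real s
        - (Measure.pi (fun j : Fin (m + 1) => μ.map (Zs ((j : ℕ) * k + t)))).real s
      ≤ m * betaMix μ Zs k := by
  have hprob (i : ℕ) : IsProbabilityMeasure (μ.map (Zs i)) :=
    Measure.isProbabilityMeasure_map (hZs i).aemeasurable
  induction m with
  | zero =>
    have : Measure.pi (fun j : Fin (0 + 1) => μ.map (Zs ((j : ℕ) * k + t)))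
        = μ.map (fun ω => fun j : Fin (0 + 1) => Zs ((j : ℕ) * k + t) ω) := by
      refine Measure.pi_eq fun u hu => ?_
      rw [Measure.map_apply (measurable_pi_lambda _ fun j => hZs _) (.univ_pi hu)]
      simp only [Nat.reduceAdd, Finset.univ_unique, Finset.prod_singleton]
      rw [Measure.map_apply (hZs _) (hu _)]
      congr 1
      ext ω
      simp [Set.mem_pi, Fin.forall_fin_one]
    rw [this]
    simp
  | succ m ih =>
    let block : Ω → Fin (m + 1) → Z := fun ω j => Zs ((j : ℕ) * k + t) ω
    let future : Ω → Z := Zs ((m + 1) * k + t)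
    have hblock : Measurable block := measurable_pi_lambda _ fun j => hZs _
    have hpi := measurePreserving_piFinSuccAbove
      (fun j : Fin (m + 1 + 1) => μ.map (Zs ((j : ℕ) * k + t))) (Fin.last _)
    let e := (MeasurableEquiv.piFinSuccAbove (fun _ : Fin (m + 1 + 1) => Z) (Fin.last _)).trans
      MeasurableEquiv.prodComm
    have he : MeasurePreserving e
        (Measure.pi (fun j : Fin (m + 1 + 1) => μ.map (Zs ((j : ℕ) * k + t))))
        ((Measure.pi fun j : Fin (m + 1) => μ.map (Zs ((j : ℕ) * k + t))).prod
          (μ.map future)) := by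
      simp only [Fin.succAbove_last, Fin.val_castSucc, Fin.val_last] at hpi
      exact Measure.measurePreserving_swap.comp hpi
    have hs' : MeasurableSet (e.symm ⁻¹' s) := e.symm.measurable hs
    have hpre : s = e ⁻¹' (e.symm ⁻¹' s) := by
      rw [← Set.preimage_comp, MeasurableEquiv.symm_comp_self, Set.preimage_id]
    have h1 : (μ.map (fun ω => fun j : Fin (m + 1 + 1) => Zs ((j : ℕ) * k + t) ω)).real s
        = (μ.map fun ω => (block ω, future ω)).real (e.symm ⁻¹' s) := by
      conv_lhs => rw [hpre]
      rw [← map_measureReal_apply e.measurable hs',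
        Measure.map_map e.measurable (measurable_pi_lambda _ fun j => hZs _)]
      congr 2
      ext ω
      · simp [e, block, MeasurableEquiv.prodComm, Fin.init]
      · simp [e, future, MeasurableEquiv.prodComm]
    have h2 : (Measure.pi (fun j : Fin (m + 1 + 1) => μ.map (Zs ((j : ℕ) * k + t)))).real s
        = ((Measure.pi fun j : Fin (m + 1) => μ.map (Zs ((j : ℕ) * k + t))).prod
          (μ.map future)).real (e.symm ⁻¹' s) := by
      conv_lhs => rw [hpre]
      exact he.measureReal_preimage hs'.nullMeasurableSet
    have hpast : Measurable[sigmaGen Zs (Set.Icc 1 (m * k + t))] block := by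
      refine @measurable_pi_lambda _ _ _ (sigmaGen Zs (Set.Icc 1 (m * k + t))) _ _ fun j => ?_
      refine measurable_sigmaGen Zs ⟨by omega, ?_⟩
      have := Nat.mul_le_mul_right k (Nat.lt_succ_iff.1 j.2)
      omega
    have hfuture : Measurable[sigmaGen Zs (Set.Ici (m * k + t + k))] future :=
      measurable_sigmaGen Zs (by rw [Set.mem_Ici]; linarith [add_mul m 1 k])
    have := Measure.isProbabilityMeasure_map (μ := μ) hblock.aemeasurable
    have h3 := measureReal_map_prodMk_sub_le_betaMix μ hZs (by omega) hpast hfuture hs'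
    have h4 := measureReal_prod_sub_le (μ.map block) _ (μ.map future) (fun u hu => ih hu) hs'
    rw [h1, h2]
    push_cast
    linarith

/-- **Lemma 1.** For any `t, n, k ≥ 1`, the total variation distance between the
joint law of the subsampled block `(Z_t, Z_{k+t}, …, Z_{(n-1)k+t})` and the product
of its marginals is at most `(n-1) β_k`. -/
theorem tvDist_block_le_betaMix
    {Ω : Type*} [MeasurableSpace Ω] (μ : Measure Ω) [IsProbabilityMeasure μ]
    {Z : Type*} [MeasurableSpace Z] (Zs : ℕ → Ω → Z) (hZs : ∀ t, Measurable (Zs t))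
    (t n k : ℕ) (ht : 1 ≤ t) (hn : 1 ≤ n) (hk : 1 ≤ k) :
    tvDist (μ.map (fun ω => fun j : Fin n => Zs ((j : ℕ) * k + t) ω))
        (Measure.pi (fun j : Fin n => μ.map (Zs ((j : ℕ) * k + t))))
      ≤ ((n : ℝ) - 1) * betaMix μ Zs k := by
  obtain ⟨m, rfl⟩ := Nat.exists_eq_add_of_le' hn
  have : Nonempty {A : Set (Fin (m + 1) → Z) // MeasurableSet A} := ⟨⟨∅, .empty⟩⟩
  refine ciSup_le fun A => (measureReal_block_sub_le μ hZs ht m A.2).trans_eq ?_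
  push_cast
  ring
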